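/- Let p be a prime, f : 𝔽_{p^n} → 𝔽_p an s₁-plateaued function and g : 𝔽_{p^m} → 𝔽_p an s₂-plateaued function. Let M be the p^n × p^n matrix with (x,y) entry ζ_p^{f(x+y)} and N the p^m × p^m matrix with (a,b) entry ζ_p^{g(a+b)}, and let P = M ⊗ N be their Kronecker product. Then P P* P = p^{n+m+s₁+s₂} P, where P* is the conjugate transpose of P. -/

import Mathlib

open scoped BigOperators Classical

noncomputable instance galFintype (p n : ℕ) [Fact p.Prime] : Fintype (GaloisField p n) :=
  Fintype.ofFinite _

/-- `eChar p k = ζ_p ^ k` where `ζ_p = exp(2πi/p)` and `k : ZMod p`. -/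
noncomputable def eChar (p : ℕ) (k : ZMod p) : ℂ :=
  Complex.exp (2 * Real.pi * Complex.I / p) ^ k.val

/-- Absolute trace `Tr_n : 𝔽_{p^n} → 𝔽_p`. -/
noncomputable def trGF (p n : ℕ) [Fact p.Prime] (x : GaloisField p n) : ZMod p :=
  Algebra.trace (ZMod p) (GaloisField p n) x

/-- Walsh transform `f̂(μ) = ∑_x ζ_p^{f(x) - Tr_n(μ x)}`. -/
noncomputable def walsh (p n : ℕ) [Fact p.Prime] (f : GaloisField p n → ZMod p)
    (μ : GaloisField p n) : ℂ :=
  ∑ x : GaloisField p n, eChar p (f x - trGF p n (μ * x))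

/-- `f` is `s`-plateaued: `|f̂(μ)| ∈ {0, p^{(n+s)/2}}` for all `μ`. -/
def IsPlateaued (p n : ℕ) [Fact p.Prime] (f : GaloisField p n → ZMod p) (s : ℕ) : Prop :=
  ∀ μ : GaloisField p n, ‖walsh p n f μ‖ = 0 ∨
    ‖walsh p n f μ‖ = (p : ℝ) ^ (((n : ℝ) + (s : ℝ)) / 2)

/-- `δ_S(g) = #{(s,t) ∈ S × S : g = s - t}`. -/
def pgdsDelta {G : Type*} [AddCommGroup G] [DecidableEq G] (S : Finset G) (g : G) : ℕ :=
  ((S ×ˢ S).filter fun st => g = st.1 - st.2).card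

/-- `S` is a partial geometric difference set with parameters `(v, k; α, β)`. -/
def IsPGDS {G : Type*} [AddCommGroup G] [Fintype G] [DecidableEq G]
    (S : Finset G) (v k α β : ℕ) : Prop :=
  Fintype.card G = v ∧ S.card = k ∧
    ∀ x : G, (∑ y ∈ S, pgdsDelta S (x - y)) = if x ∈ S then β else α

open scoped Kronecker

section WalshMatrix

open Matrix

variable {p n : ℕ} [Fact p.Prime]

theorem eChar_eq_stdAddChar (k : ZMod p) : eChar p k = ZMod.stdAddChar k := by
  have h := ZMod.stdAddChar_coe (N := p) (k.val : ℤ)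
  rw [Int.cast_natCast, ZMod.natCast_zmod_val] at h
  rw [h, eChar, ← Complex.exp_nat_mul]
  congr 1
  push_cast
  ring

/-- The canonical additive character `x ↦ ζ_p ^ Tr_n(x)` of `𝔽_{p^n}`. -/
noncomputable def traceChar (p n : ℕ) [Fact p.Prime] : AddChar (GaloisField p n) ℂ :=
  (ZMod.stdAddChar (N := p)).compAddMonoidHom
    (Algebra.trace (ZMod p) (GaloisField p n)).toAddMonoidHom

theorem traceChar_apply (x : GaloisField p n) :
    traceChar p n x = ZMod.stdAddChar (trGF p n x) := rfl

theorem traceChar_isPrimitive : (traceChar p n).IsPrimitive := by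
  apply AddChar.IsPrimitive.of_ne_one
  intro h
  obtain ⟨x, hx⟩ := Algebra.trace_surjective (ZMod p) (GaloisField p n) 1
  have h1 : ZMod.stdAddChar (1 : ZMod p) = (1 : ℂ) := by
    rw [← hx]
    exact DFunLike.congr_fun h x
  rw [← AddChar.map_zero_eq_one (ZMod.stdAddChar (N := p))] at h1
  exact one_ne_zero (ZMod.injective_stdAddChar h1)

/-- The character table `(x, μ) ↦ ζ_p ^ Tr_n(μ x)` of `𝔽_{p^n}`. -/
noncomputable def charMatrix (p n : ℕ) [Fact p.Prime] :
    Matrix (GaloisField p n) (GaloisField p n) ℂ :=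
  of fun x μ => traceChar p n (μ * x)

theorem star_traceChar (x : GaloisField p n) :
    star (traceChar p n x) = traceChar p n (-x) :=
  (AddChar.map_neg_eq_conj _ _).symm

theorem charMatrix_conjTranspose_mul :
    (charMatrix p n)ᴴ * charMatrix p n =
      (Fintype.card (GaloisField p n) : ℂ) • (1 : Matrix _ _ ℂ) := by
  ext μ ν
  have h := AddChar.sum_mulShift (R := GaloisField p n) (ν - μ) (traceChar_isPrimitive (p := p))
  simp only [mul_apply, conjTranspose_apply, charMatrix, of_apply, star_traceChar,
    ← AddChar.map_add_eq_mul, Matrix.smul_apply, one_apply, smul_eq_mul]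
  calc _ = ∑ x, traceChar p n (x * (ν - μ)) := Finset.sum_congr rfl fun x _ => by congr 1; ring
    _ = _ := by rw [h]; simp [sub_eq_zero, eq_comm]

/-- A plateaued function satisfies `f̂ · conj f̂ · f̂ = p^{n+s} f̂` pointwise. -/
theorem IsPlateaued.walsh_mul_star_mul {f : GaloisField p n → ZMod p} {s : ℕ}
    (hf : IsPlateaued p n f s) (μ : GaloisField p n) :
    walsh p n f μ * star (walsh p n f μ) * walsh p n f μ = (p : ℂ) ^ (n + s) * walsh p n f μ := by
  rcases hf μ with h | h
  · simp [norm_eq_zero.mp h]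
  · congr 1
    have hp : (‖walsh p n f μ‖ ^ 2 : ℝ) = (p : ℝ) ^ (n + s) := by
      rw [h, ← Real.rpow_natCast, ← Real.rpow_mul (by positivity), ← Real.rpow_natCast]
      congr 1
      push_cast
      ring
    rw [Complex.star_def, Complex.mul_conj']
    exact_mod_cast hp

/-- Fourier analysis diagonalizes `M`, up to conjugating the characters. -/
theorem mul_charMatrix_conjTranspose {f : GaloisField p n → ZMod p}
    {M : Matrix (GaloisField p n) (GaloisField p n) ℂ}
    (hM : ∀ x y : GaloisField p n, M x y = eChar p (f (x + y))) :
    M * (charMatrix p n)ᴴ = charMatrix p n * diagonal (walsh p n f) := by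
  ext x ν
  rw [mul_diagonal, mul_apply, walsh, Finset.mul_sum]
  conv_rhs => rw [← Equiv.sum_comp (Equiv.addLeft x)]
  simp only [conjTranspose_apply, charMatrix, of_apply, star_traceChar, hM]
  refine Finset.sum_congr rfl fun y _ => ?_
  have h : f (x + y) + trGF p n (-(y * ν)) =
      trGF p n (ν * x) + (f (x + y) - trGF p n (ν * (x + y))) := by
    simp only [trGF, mul_add, map_add, map_neg, mul_comm y ν]
    ring
  rw [eChar_eq_stdAddChar, eChar_eq_stdAddChar, traceChar_apply, traceChar_apply,
    ← AddChar.map_add_eq_mul, ← AddChar.map_add_eq_mul, Equiv.coe_addLeft, h]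

theorem IsPlateaued.mul_conjTranspose_mul {f : GaloisField p n → ZMod p} {s : ℕ}
    (hf : IsPlateaued p n f s) {M : Matrix (GaloisField p n) (GaloisField p n) ℂ}
    (hM : ∀ x y : GaloisField p n, M x y = eChar p (f (x + y))) :
    M * Mᴴ * M = (p : ℂ) ^ (n + s) • M := by
  set U := charMatrix p n with hU
  set D := diagonal (walsh p n f) with hD
  have hMU : M * Uᴴ = U * D := mul_charMatrix_conjTranspose hM
  have hMt : Mᵀ = M := by
    ext x y
    rw [transpose_apply, hM, hM, add_comm]
  have hUt : Uᵀ = U := by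
    ext x y
    simp [hU, charMatrix, mul_comm]
  have hMhU : Mᴴ * U = Uᴴ * Dᴴ := by
    have h := congrArg (fun A => Aᴴᵀ) hMU
    have hMc : Mᴴᵀ = Mᴴ := (congrArg (·.map star) hMt).symm
    have hUc : Uᴴᵀ = Uᴴ := (congrArg (·.map star) hUt).symm
    have hDc : Dᴴᵀ = Dᴴ := by rw [hD, diagonal_conjTranspose, diagonal_transpose]
    simpa only [conjTranspose_mul, transpose_mul, conjTranspose_conjTranspose, hMc, hUc, hDc, hUt]
      using h
  have hDDD : D * Dᴴ * D = (p : ℂ) ^ (n + s) • D := by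
    rw [hD, diagonal_conjTranspose, diagonal_mul_diagonal, diagonal_mul_diagonal, ← diagonal_smul]
    exact congrArg diagonal (funext hf.walsh_mul_star_mul)
  have key : M * Mᴴ * M * Uᴴ = (p : ℂ) ^ (n + s) • M * Uᴴ := by
    calc M * Mᴴ * M * Uᴴ = M * (Mᴴ * U) * D := by simp only [Matrix.mul_assoc, hMU]
      _ = U * (D * Dᴴ * D) := by
        rw [hMhU, ← Matrix.mul_assoc, hMU]; simp only [Matrix.mul_assoc]
      _ = (p : ℂ) ^ (n + s) • M * Uᴴ := by rw [hDDD, Matrix.mul_smul, Matrix.smul_mul, hMU]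
  have hcard : (Fintype.card (GaloisField p n) : ℂ) ≠ 0 := Nat.cast_ne_zero.mpr Fintype.card_ne_zero
  have h := congrArg (· * U) key
  simp only [Matrix.mul_assoc _ Uᴴ U] at h
  rw [hU, charMatrix_conjTranspose_mul] at h
  simpa only [Matrix.mul_smul, Matrix.mul_one, smul_right_inj hcard] using h

end WalshMatrix

/-- if `f` is `s₁`-plateaued with matrix `M` (`M_{x,y} = ζ_p^{f(x+y)}`) and
`g` is `s₂`-plateaued with matrix `N` (`N_{a,b} = ζ_p^{g(a+b)}`), then the Kronecker
product `P = M ⊗ N` satisfies `P P* P = p^{n+m+s₁+s₂} P`. -/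
theorem stmt12 (p n m : ℕ) [Fact p.Prime] (hn : 0 < n) (hm : 0 < m) (s₁ s₂ : ℕ)
    (f : GaloisField p n → ZMod p) (g : GaloisField p m → ZMod p)
    (hf : IsPlateaued p n f s₁) (hg : IsPlateaued p m g s₂)
    (M : Matrix (GaloisField p n) (GaloisField p n) ℂ)
    (hM : ∀ x y : GaloisField p n, M x y = eChar p (f (x + y)))
    (N : Matrix (GaloisField p m) (GaloisField p m) ℂ)
    (hN : ∀ a b : GaloisField p m, N a b = eChar p (g (a + b))) :
    (M ⊗ₖ N) * (M ⊗ₖ N).conjTranspose * (M ⊗ₖ N) =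
      ((p : ℂ) ^ (n + m + s₁ + s₂)) • (M ⊗ₖ N) := by
  rw [Matrix.conjTranspose_kronecker, ← Matrix.mul_kronecker_mul, ← Matrix.mul_kronecker_mul,
    hf.mul_conjTranspose_mul hM, hg.mul_conjTranspose_mul hN, Matrix.smul_kronecker,
    Matrix.kronecker_smul, smul_smul, ← pow_add]
  congr 2
  ring
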